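/- For any integer m ≥ 1 there exists a constant c = c(m) ≥ 0 such that the following holds. Let (X,d) be a strongly geodesic 1-hyperbolic G-space, let V' ≤ G be a nontrivial subgroup, and let M' = (V'; H') be a G-pair with H' = (h'₁,…,h'_m). Then M' is equivalent to a minimal G-pair M = (V; H = (h₁,…,h_m)) such that l_V(h v h̄) ≥ l_V(h) + l_V(h̄) − c for all h, h̄ ∈ {h₁, h₁⁻¹, …, h_m, h_m⁻¹} and all v ∈ V with v ≠ 1. -/

import Mathlib

noncomputable section

namespace KW

open Metric Set Pointwise

variable {X : Type*} [MetricSpace X]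

/-- `s` is (the image of) a unit-speed geodesic segment joining `x` to `y`. -/
def IsGeodesicSegment (s : Set X) (x y : X) : Prop :=
  ∃ (b : ℝ) (f : ℝ → X), 0 ≤ b ∧ f 0 = x ∧ f b = y ∧
    (∀ u ∈ Set.Icc (0 : ℝ) b, ∀ v ∈ Set.Icc (0 : ℝ) b, dist (f u) (f v) = |u - v|) ∧
    s = f '' Set.Icc 0 b

/-- A geodesic metric space. -/
def GeodesicSpace (X : Type*) [MetricSpace X] : Prop :=
  ∀ x y : X, ∃ s : Set X, IsGeodesicSegment s x y

/-- `X` is `δ`-hyperbolic: geodesic, and every geodesic triangle is `δ`-thin. -/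
def DeltaHyperbolic (δ : ℝ) (X : Type*) [MetricSpace X] : Prop :=
  GeodesicSpace X ∧
    ∀ (x y z : X) (s₁ s₂ s₃ : Set X),
      IsGeodesicSegment s₁ x y → IsGeodesicSegment s₂ y z → IsGeodesicSegment s₃ x z →
      ∀ p ∈ s₁, ∃ q ∈ s₂ ∪ s₃, dist p q ≤ δ

/-- `A` is an `ε`-quasiconvex subset of `X`. -/
def Quasiconvex (ε : ℝ) (A : Set X) : Prop :=
  ∀ x ∈ A, ∀ y ∈ A, ∀ s : Set X, IsGeodesicSegment s x y → ∀ p ∈ s, ∃ a ∈ A, dist p a ≤ ε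

/-- The Gromov product `(y,z)_x`. -/
def gromov (x y z : X) : ℝ := (dist y x + dist z x - dist y z) / 2

def IsGeodesicRay (γ : ℝ → X) : Prop :=
  ∀ s t : ℝ, 0 ≤ s → 0 ≤ t → dist (γ s) (γ t) = |s - t|

def IsBiGeodesic (γ : ℝ → X) : Prop :=
  ∀ s t : ℝ, dist (γ s) (γ t) = |s - t|

/-- `A` and `B` are `K`-Hausdorff close. -/
def HClose (K : ℝ) (A B : Set X) : Prop :=
  (∀ a ∈ A, ∃ b ∈ B, dist a b ≤ K) ∧ ∀ b ∈ B, ∃ a ∈ A, dist a b ≤ K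

def HausdorffClose (A B : Set X) : Prop := ∃ K : ℝ, HClose K A B

/-- Two geodesic rays are asymptotic iff their images are Hausdorff close. -/
def Asymptotic (γ γ' : ℝ → X) : Prop :=
  HausdorffClose (γ '' Set.Ici 0) (γ' '' Set.Ici 0)

def GRay (X : Type*) [MetricSpace X] : Type _ := {γ : ℝ → X // IsGeodesicRay γ}

theorem asymptotic_refl (γ : ℝ → X) : Asymptotic γ γ :=
  ⟨0, fun a ha => ⟨a, ha, by simp⟩, fun b hb => ⟨b, hb, by simp⟩⟩

theorem asymptotic_symm {γ γ' : ℝ → X} (h : Asymptotic γ γ') : Asymptotic γ' γ := by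
  obtain ⟨K, h₁, h₂⟩ := h
  refine ⟨K, fun a ha => ?_, fun b hb => ?_⟩
  · obtain ⟨b, hb, hd⟩ := h₂ a ha
    exact ⟨b, hb, by rwa [dist_comm]⟩
  · obtain ⟨a, ha, hd⟩ := h₁ b hb
    exact ⟨a, ha, by rwa [dist_comm]⟩

theorem asymptotic_trans {γ₁ γ₂ γ₃ : ℝ → X} (h : Asymptotic γ₁ γ₂)
    (h' : Asymptotic γ₂ γ₃) : Asymptotic γ₁ γ₃ := by
  obtain ⟨K, h₁, h₂⟩ := h
  obtain ⟨K', h₁', h₂'⟩ := h'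
  refine ⟨K + K', fun a ha => ?_, fun c hc => ?_⟩
  · obtain ⟨b, hb, hab⟩ := h₁ a ha
    obtain ⟨c, hc, hbc⟩ := h₁' b hb
    exact ⟨c, hc, (dist_triangle a b c).trans (by linarith)⟩
  · obtain ⟨b, hb, hbc⟩ := h₂' c hc
    obtain ⟨a, ha, hab⟩ := h₂ b hb
    exact ⟨a, ha, (dist_triangle a b c).trans (by linarith)⟩

def raySetoid (X : Type*) [MetricSpace X] : Setoid (GRay X) where
  r γ γ' := Asymptotic γ.1 γ'.1
  iseqv := ⟨fun γ => asymptotic_refl γ.1, fun h => asymptotic_symm h,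
    fun h h' => asymptotic_trans h h'⟩

/-- The (geodesic) boundary of `X`: asymptoty classes of geodesic rays. -/
def Boundary (X : Type*) [MetricSpace X] : Type _ := Quotient (raySetoid X)

def Boundary.mk {X : Type*} [MetricSpace X] (γ : GRay X) : Boundary X :=
  Quotient.mk (raySetoid X) γ

/-- A strongly geodesic metric space. -/
def StronglyGeodesic (X : Type*) [MetricSpace X] : Prop :=
  GeodesicSpace X ∧
  (∀ γ : ℝ → X, IsGeodesicRay γ → ∀ y : X,
      ∃ γ' : ℝ → X, IsGeodesicRay γ' ∧ γ' 0 = y ∧ Asymptotic γ γ') ∧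
  (∀ γ₁ γ₂ : ℝ → X, IsGeodesicRay γ₁ → IsGeodesicRay γ₂ → γ₁ 0 = γ₂ 0 →
      ¬ Asymptotic γ₁ γ₂ →
      ∃ γ : ℝ → X, IsBiGeodesic γ ∧
        HausdorffClose (Set.range γ) (γ₁ '' Set.Ici 0 ∪ γ₂ '' Set.Ici 0)) ∧
  (∀ (x : X) (u : ℕ → X),
      (∀ M : ℝ, ∃ N : ℕ, ∀ n, N ≤ n → ∀ m, N ≤ m → M ≤ gromov x (u n) (u m)) →
      ∃ γ : ℝ → X, IsGeodesicRay γ ∧ γ 0 = x ∧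
        ∀ M : ℝ, ∃ N : ℕ, ∀ n, N ≤ n → ∀ m, N ≤ m → M ≤ gromov x (γ (n : ℝ)) (u m))

/-- The sequence `u` converges to the boundary point `p`, with basepoint `x`. -/
def SeqConvTo (x : X) (u : ℕ → X) (p : Boundary X) : Prop :=
  ∃ γ : GRay X, Boundary.mk γ = p ∧
    ∀ M : ℝ, ∃ N : ℕ, ∀ n, N ≤ n → ∀ m, N ≤ m → M ≤ gromov x (u n) (γ.1 (m : ℝ))

/-- `γ` is a geodesic ray in the class of the boundary point `p`. -/
def RayTo (γ : ℝ → X) (p : Boundary X) : Prop :=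
  ∃ h : IsGeodesicRay γ, Boundary.mk ⟨γ, h⟩ = p

/-- `γ` is a biinfinite geodesic whose two ends converge to `p` and `q`. -/
def BiGeodesicJoins (γ : ℝ → X) (p q : Boundary X) : Prop :=
  IsBiGeodesic γ ∧ SeqConvTo (γ 0) (fun n => γ (-(n : ℝ))) p ∧
    SeqConvTo (γ 0) (fun n => γ (n : ℝ)) q

/-- `s` is (the image of) a geodesic joining two points of `X ∪ ∂X`. -/
def JoinSet : X ⊕ Boundary X → X ⊕ Boundary X → Set X → Prop
  | Sum.inl x, Sum.inl y, s => IsGeodesicSegment s x y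
  | Sum.inl x, Sum.inr p, s => ∃ γ : ℝ → X, γ 0 = x ∧ RayTo γ p ∧ s = γ '' Set.Ici 0
  | Sum.inr p, Sum.inl x, s => ∃ γ : ℝ → X, γ 0 = x ∧ RayTo γ p ∧ s = γ '' Set.Ici 0
  | Sum.inr p, Sum.inr q, s => ∃ γ : ℝ → X, BiGeodesicJoins γ p q ∧ s = Set.range γ

/-- The convex hull `Conv(A)` of a subset `A ⊆ X ∪ ∂X`. -/
def geoConv (A : Set (X ⊕ Boundary X)) : Set X :=
  {x | (∃ a : X, A = {Sum.inl a} ∧ x = a) ∨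
    ∃ p ∈ A, ∃ q ∈ A, p ≠ q ∧ ∃ s : Set X, JoinSet p q s ∧ x ∈ s}

/-- The distance between two subsets of `X`. -/
def setDist (A B : Set X) : ℝ := sInf (Set.image2 dist A B)

/-- `a` is a projection of `p` on `A` (relative to `δ`). -/
def IsProjection (δ : ℝ) (A : Set X) (p a : X) : Prop :=
  a ∈ A ∧ ∀ a' ∈ A, dist p a ≤ dist p a' + δ

/-- `f` restricted to `[0,L]` is a unit-speed geodesic from `x` to `y`. -/
def GeodParam (f : ℝ → X) (L : ℝ) (x y : X) : Prop :=
  0 ≤ L ∧ f 0 = x ∧ f L = y ∧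
    ∀ u ∈ Set.Icc (0 : ℝ) L, ∀ v ∈ Set.Icc (0 : ℝ) L, dist (f u) (f v) = |u - v|

/-- Concatenation of three paths, the first on `[0,a]`, the second on `[0,b]`. -/
def concat3 (f₁ f₂ f₃ : ℝ → X) (a b : ℝ) : ℝ → X := fun t =>
  if t ≤ a then f₁ t else if t ≤ a + b then f₂ (t - a) else f₃ (t - a - b)

/-- `f` is a `(lam, ε)`-quasigeodesic on `[a,b]`. -/
def QuasigeodesicOn (lam ε : ℝ) (f : ℝ → X) (a b : ℝ) : Prop :=
  ∀ s ∈ Set.Icc a b, ∀ t ∈ Set.Icc a b, |s - t| ≤ lam * dist (f s) (f t) + ε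

/-- The action of `G` on `X` is by isometries. -/
def IsometricAction (G Y : Type*) [Group G] [MetricSpace Y] [MulAction G Y] : Prop :=
  ∀ (g : G) (x y : Y), dist (g • x) (g • y) = dist x y

section GroupAction

variable {G : Type*} [Group G]

/-- The limit set `Λ(U) ⊆ ∂X` of a subgroup `U ≤ G`. -/
def limitSet (X : Type*) [MetricSpace X] [MulAction G X] (U : Subgroup G) :
    Set (Boundary X) :=
  {p | ∃ x₀ : X, ∃ u : ℕ → U, SeqConvTo x₀ (fun n => ((u n : G)) • x₀) p}

/-- The small displacement set `E(U)` (relative to `δ`). -/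
def smallDispSet (X : Type*) [MetricSpace X] [MulAction G X] (δ : ℝ) (U : Subgroup G) :
    Set X :=
  {x | ∃ u : G, u ∈ U ∧ u ≠ 1 ∧ dist x (u • x) ≤ 100 * δ}

/-- `Z(U) = Conv(Λ(U) ∪ E(U))`. -/
def ZSet (X : Type*) [MetricSpace X] [MulAction G X] (δ : ℝ) (U : Subgroup G) : Set X :=
  geoConv (Sum.inr '' limitSet X U ∪ Sum.inl '' smallDispSet X δ U)

/-- The convex hull `X(U)`: the closure of `Conv(Z(U))`. -/
def cHull (X : Type*) [MetricSpace X] [MulAction G X] (δ : ℝ) (U : Subgroup G) : Set X :=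
  closure (geoConv (Sum.inl '' ZSet X δ U))

/-- The weak convex hull `X_U = Conv(Λ(U))`. -/
def weakHull (X : Type*) [MetricSpace X] [MulAction G X] (U : Subgroup G) : Set X :=
  geoConv (Sum.inr '' limitSet X U)

/-- `l_V(g) = d(X(V), gX(V))`. -/
def lV (X : Type*) [MetricSpace X] [MulAction G X] (δ : ℝ) (V : Subgroup G) (g : G) : ℝ :=
  setDist (cHull X δ V) (g • cHull X δ V)

/-- The translation length of `g`. -/
def translationLength (X : Type*) [MetricSpace X] [MulAction G X] (g : G) : ℝ :=
  sInf (Set.range fun x : X => dist x (g • x))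

/-- The asymptotic translation length of `g`. -/
def asympTranslationLength (X : Type*) [MetricSpace X] [MulAction G X] (g : G) : ℝ :=
  Filter.liminf (fun n : ℕ => translationLength X (g ^ n) / (n : ℝ)) Filter.atTop

/-- An elementary move between `G`-tuples `(U₁,…,U_n; h₁,…,h_m)`. -/
def gMove {n m : ℕ} (M M' : (Fin n → Subgroup G) × (Fin m → G)) : Prop :=
  (M'.2 = M.2 ∧ ∃ (j : Fin n) (g : G),
      g ∈ Subgroup.closure (Set.range M.2 ∪ ⋃ i ∈ {i : Fin n | i ≠ j}, ((M.1 i : Set G))) ∧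
      (∀ i, i ≠ j → M'.1 i = M.1 i) ∧
      M'.1 j = Subgroup.map (MulAut.conj g).toMonoidHom (M.1 j)) ∨
  (M'.1 = M.1 ∧ ∃ (i : Fin m) (g₁ g₂ : G),
      g₁ ∈ Subgroup.closure (M.2 '' {j : Fin m | j ≠ i} ∪ ⋃ t, ((M.1 t : Set G))) ∧
      g₂ ∈ Subgroup.closure (M.2 '' {j : Fin m | j ≠ i} ∪ ⋃ t, ((M.1 t : Set G))) ∧
      (∀ j, j ≠ i → M'.2 j = M.2 j) ∧
      M'.2 i = g₁ * M.2 i * g₂)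

/-- Equivalence of `G`-tuples: a finite chain of elementary moves. -/
def gEquiv {n m : ℕ} :
    (Fin n → Subgroup G) × (Fin m → G) → (Fin n → Subgroup G) × (Fin m → G) → Prop :=
  Relation.ReflTransGen gMove

/-- The family of factors `U₁,…,U_n, F(h₁),…,F(h_m)`. -/
def FF {n : ℕ} (m : ℕ) (U : Fin n → Subgroup G) : Fin n ⊕ Fin m → Type _
  | Sum.inl j => ↥(U j)
  | Sum.inr _ => FreeGroup PUnit

instance ffGroup {n : ℕ} (m : ℕ) (U : Fin n → Subgroup G) :
    (i : Fin n ⊕ Fin m) → Group (FF m U i)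
  | Sum.inl j => inferInstanceAs (Group ↥(U j))
  | Sum.inr _ => inferInstanceAs (Group (FreeGroup PUnit))

def ffHoms {n m : ℕ} (U : Fin n → Subgroup G) (H : Fin m → G) :
    (i : Fin n ⊕ Fin m) → FF m U i →* G
  | Sum.inl j => (U j).subtype
  | Sum.inr j => FreeGroup.lift fun _ => H j

/-- The canonical homomorphism `U₁ ∗ ⋯ ∗ U_n ∗ F(H) → G`. -/
def freeProdHom {n m : ℕ} (U : Fin n → Subgroup G) (H : Fin m → G) :
    Monoid.CoprodI (FF m U) →* G :=
  Monoid.CoprodI.lift (ffHoms U H)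

/-- `W = U₁ ∗ ⋯ ∗ U_n ∗ F(H)`: the canonical homomorphism is injective with image `W`. -/
def IsFreeProdDecomp {n m : ℕ} (U : Fin n → Subgroup G) (H : Fin m → G)
    (W : Subgroup G) : Prop :=
  Function.Injective (freeProdHom U H) ∧ (freeProdHom U H).range = W

/-- Minimality of the `G`-pair `(V; H)` (relative to a `1`-hyperbolic `G`-space `X`). -/
def PairMinimal (X : Type*) [MetricSpace X] [MulAction G X] {m : ℕ}
    (V : Subgroup G) (H : Fin m → G) : Prop :=
  ∀ (V' : Subgroup G) (H' : Fin m → G),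
    gEquiv ((fun _ : Fin 1 => V), H) ((fun _ : Fin 1 => V'), H') →
    (∑ i, lV X 1 V (H i)) ≤ (∑ i, lV X 1 V' (H' i)) + 1

/-- An elementary Nielsen move on tuples of elements of `G`. -/
def NielsenMove {k : ℕ} (g g' : Fin k → G) : Prop :=
  (∃ i : Fin k, (∀ j, j ≠ i → g' j = g j) ∧ g' i = (g i)⁻¹) ∨
  (∃ i j : Fin k, i ≠ j ∧ (∀ t, t ≠ i → g' t = g t) ∧ g' i = g i * g j) ∨
  (∃ i j : Fin k, i ≠ j ∧ g' = g ∘ Equiv.swap i j)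

/-- Nielsen equivalence: a finite chain of elementary Nielsen moves. -/
def NielsenEq {k : ℕ} : (Fin k → G) → (Fin k → G) → Prop :=
  Relation.ReflTransGen NielsenMove

/-- Word length of `g` with respect to the (symmetrized) generating set `S`. -/
def wordLength (S : Set G) (g : G) : ℕ :=
  sInf {n : ℕ | ∃ f : Fin n → G, (∀ i, f i ∈ S ∨ (f i)⁻¹ ∈ S) ∧ (List.ofFn f).prod = g}

/-- `(X, ι)` is a model of the Cayley graph `Γ(G,S)`. -/
def IsCayleyGraph (G : Type*) [Group G] (S : Set G) (X : Type*) [MetricSpace X]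
    [MulAction G X] (ι : G → X) : Prop :=
  IsometricAction G X ∧
  (∀ g h : G, ι (g * h) = g • ι h) ∧
  Function.Injective ι ∧
  GeodesicSpace X ∧
  (∀ g h : G, dist (ι g) (ι h) = (wordLength S (g⁻¹ * h) : ℝ)) ∧
  ∀ x : X, ∃ g h : G, wordLength S (g⁻¹ * h) ≤ 1 ∧
    ∃ s : Set X, IsGeodesicSegment s (ι g) (ι h) ∧ x ∈ s

/-- `H` is a quasiconvex subgroup (with respect to the Cayley graph model `(X, ι)`). -/
def QCSubgroup (X : Type*) [MetricSpace X] (ι : G → X) (H : Subgroup G) : Prop :=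
  ∃ ε : ℝ, 0 ≤ ε ∧ Quasiconvex ε (ι '' (H : Set G))

end GroupAction

/-- Every nontrivial element of finite order has finite centralizer. -/
def AlmostTorsionFree (G : Type*) [Group G] : Prop :=
  ∀ g : G, g ≠ 1 → IsOfFinOrder g → ((Subgroup.centralizer {g} : Subgroup G) : Set G).Finite

/-- `U` is nontrivial and admits no nontrivial free product decomposition. -/
def FreelyIndecomposable (U : Type*) [Group U] : Prop :=
  Nontrivial U ∧
    ¬ ∃ A B : Subgroup U, A ≠ ⊥ ∧ B ≠ ⊥ ∧
        Function.Bijective (Monoid.Coprod.lift A.subtype B.subtype)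

def InfiniteCyclic (U : Type*) [Group U] : Prop := Infinite U ∧ IsCyclic U

def VirtuallyCyclic (U : Type*) [Group U] : Prop :=
  ∃ H : Subgroup U, H.index ≠ 0 ∧ IsCyclic ↥H

def NonElementary (U : Type*) [Group U] : Prop := ¬ Finite U ∧ ¬ VirtuallyCyclic U

end KW

universe u v

namespace KW

open Pointwise Metric Set

section Helpers

variable {X : Type*} [MetricSpace X]

theorem seg_symm {s : Set X} {x y : X} (h : IsGeodesicSegment s x y) :
    IsGeodesicSegment s y x := by
  obtain ⟨b, f, hb, h0, h1, hf, rfl⟩ := h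
  refine ⟨b, fun t => f (b - t), hb, by simpa using h1, by simpa using h0, ?_, ?_⟩
  · intro u hu v hv
    rw [hf (b - u) ⟨by linarith [hu.2], by linarith [hu.1]⟩ (b - v)
      ⟨by linarith [hv.2], by linarith [hv.1]⟩, abs_sub_comm]
    congr 1; ring
  · ext z
    constructor
    · rintro ⟨t, ht, rfl⟩
      exact ⟨b - t, ⟨by linarith [ht.2], by linarith [ht.1]⟩, by simp⟩
    · rintro ⟨t, ht, rfl⟩
      exact ⟨b - t, ⟨by linarith [ht.2], by linarith [ht.1]⟩, rfl⟩

theorem seg_left_mem {s : Set X} {x y : X} (h : IsGeodesicSegment s x y) : x ∈ s := by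
  obtain ⟨b, f, hb, h0, h1, hf, rfl⟩ := h
  exact ⟨0, ⟨le_refl _, hb⟩, h0⟩

theorem seg_dist {s : Set X} {x y z : X} (h : IsGeodesicSegment s x y) (hz : z ∈ s) :
    dist x z + dist z y = dist x y := by
  obtain ⟨b, f, hb, h0, h1, hf, rfl⟩ := h
  obtain ⟨t, ht, rfl⟩ := hz
  have z0 : (0 : ℝ) ∈ Set.Icc (0 : ℝ) b := ⟨le_refl _, hb⟩
  have zb : b ∈ Set.Icc (0 : ℝ) b := ⟨hb, le_refl _⟩
  rw [← h0, ← h1, hf _ z0 _ ht, hf _ ht _ zb, hf _ z0 _ zb,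
    abs_of_nonpos (by linarith [ht.1]), abs_of_nonpos (by linarith [ht.2]),
    abs_of_nonpos (by linarith)]
  ring

theorem seg_sub {s : Set X} {x y z : X} (h : IsGeodesicSegment s x y) (hz : z ∈ s) :
    ∃ s', s' ⊆ s ∧ IsGeodesicSegment s' x z := by
  obtain ⟨b, f, hb, h0, h1, hf, rfl⟩ := h
  obtain ⟨t, ht, rfl⟩ := hz
  refine ⟨f '' Set.Icc 0 t, Set.image_mono (Set.Icc_subset_Icc_right ht.2), t, f, ht.1, h0, rfl,
    ?_, rfl⟩
  intro u hu v hv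
  exact hf u ⟨hu.1, hu.2.trans ht.2⟩ v ⟨hv.1, hv.2.trans ht.2⟩

theorem seg_point {s : Set X} {x y : X} (h : IsGeodesicSegment s x y) {t : ℝ} (ht : 0 ≤ t)
    (ht' : t ≤ dist x y) : ∃ z ∈ s, dist x z = t ∧ dist z y = dist x y - t := by
  have h' := h
  obtain ⟨b, f, hb, h0, h1, hf, rfl⟩ := h
  have z0 : (0 : ℝ) ∈ Set.Icc (0 : ℝ) b := ⟨le_refl _, hb⟩
  have zb : b ∈ Set.Icc (0 : ℝ) b := ⟨hb, le_refl _⟩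
  have hd : dist x y = b := by
    rw [← h0, ← h1, hf _ z0 _ zb, abs_of_nonpos (by linarith)]; ring
  have hm : t ∈ Set.Icc (0 : ℝ) b := ⟨ht, by linarith⟩
  have hx : dist x (f t) = t := by
    rw [← h0, hf _ z0 _ hm, abs_of_nonpos (by linarith)]; ring
  have := seg_dist h' (z := f t) ⟨t, hm, rfl⟩
  exact ⟨f t, ⟨t, hm, rfl⟩, hx, by linarith⟩

theorem near_center (hyp : DeltaHyperbolic 1 X) (p x z : X) {s : Set X}
    (hs : IsGeodesicSegment s x z) :
    ∃ r ∈ s, 2 * dist p r ≤ dist p x + dist p z - dist x z + 6 := by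
  obtain ⟨s1, h1⟩ := hyp.1 p x
  obtain ⟨s2, h2⟩ := hyp.1 p z
  have hs' := hs
  obtain ⟨b, f, hb, f0, fb, hf, rfl⟩ := hs
  set T : Set ℝ := {t | t ∈ Set.Icc (0 : ℝ) b ∧ ∃ a ∈ s1, dist (f t) a ≤ 1} with hT
  have T0 : (0 : ℝ) ∈ T :=
    ⟨⟨le_refl _, hb⟩, x, seg_left_mem (seg_symm h1), by rw [f0, dist_self]; norm_num⟩
  have Tb : BddAbove T := ⟨b, fun t ht => ht.1.2⟩
  obtain ⟨t, htT, ht⟩ := exists_lt_of_lt_csSup ⟨0, T0⟩ (show sSup T - 1 / 2 < sSup T by linarith)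
  have htle : t ≤ sSup T := le_csSup Tb htT
  have key : ∃ q ∈ s2, dist (f t) q ≤ 2 := by
    by_cases hc : sSup T + 1 / 2 ≤ b
    · have hu : sSup T + 1 / 2 ∈ Set.Icc (0 : ℝ) b := ⟨by linarith [htT.1.1], hc⟩
      obtain ⟨q, hq, hd⟩ := hyp.2 x z p _ s2 s1 hs' (seg_symm h2) (seg_symm h1)
        (f (sSup T + 1 / 2)) ⟨_, hu, rfl⟩
      rcases hq with hq | hq
      · refine ⟨q, hq, ?_⟩
        have e := hf t htT.1 _ hu
        rw [abs_of_nonpos (by linarith)] at e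
        have := dist_triangle (f t) (f (sSup T + 1 / 2)) q
        linarith
      · have : sSup T + 1 / 2 ∈ T := ⟨hu, q, hq, hd⟩
        have := le_csSup Tb this
        linarith
    · push Not at hc
      refine ⟨z, seg_left_mem (seg_symm h2), ?_⟩
      rw [← fb, hf t htT.1 b ⟨hb, le_refl _⟩, abs_of_nonpos (by linarith [htT.1.2])]
      linarith
  obtain ⟨q, hq, hdq⟩ := key
  obtain ⟨htI, a, ha, hda⟩ := htT
  refine ⟨f t, ⟨t, htI, rfl⟩, ?_⟩
  have e1 := seg_dist h1 ha
  have e2 := seg_dist h2 hq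
  have e3 := seg_dist hs' (z := f t) ⟨t, htI, rfl⟩
  have i1 := dist_triangle p a (f t)
  have i2 := dist_triangle p q (f t)
  have i3 := dist_triangle x a (f t)
  have i4 := dist_triangle (f t) q z
  rw [dist_comm a (f t)] at i1 i3
  rw [dist_comm q (f t)] at i2
  rw [dist_comm a x] at e1
  linarith

/-- The four point condition. -/
def P4 (X : Type*) [MetricSpace X] : Prop :=
  ∀ a b c d : X, dist a b + dist c d ≤
    max (dist a c + dist b d) (dist a d + dist b c) + 10

theorem p4_of_hyp (hyp : DeltaHyperbolic 1 X) : P4 X := by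
  intro a b c d
  obtain ⟨s, hs⟩ := hyp.1 a b
  obtain ⟨s2, h2⟩ := hyp.1 b c
  obtain ⟨s3, h3⟩ := hyp.1 a c
  obtain ⟨r, hr, hd⟩ := near_center hyp d a b hs
  obtain ⟨q, hq, hqd⟩ := hyp.2 a b c s s2 s3 hs h2 h3 r hr
  have i0 := dist_triangle d r q
  rw [dist_comm c d, dist_comm b d, dist_comm a d]
  rcases hq with hq | hq
  · have e := seg_dist h2 hq
    have i1 := dist_triangle d q b
    have i2 := dist_triangle d q c
    rw [dist_comm q b] at i1
    have := le_max_right (dist a c + dist d b) (dist d a + dist b c)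
    linarith
  · have e := seg_dist h3 hq
    have i1 := dist_triangle d q a
    have i2 := dist_triangle d q c
    rw [dist_comm q a] at i1
    have := le_max_left (dist a c + dist d b) (dist d a + dist b c)
    linarith

/-- Coarse quasiconvexity. -/
def QC5 (Y : Set X) : Prop := ∀ p ∈ Y, ∀ q ∈ Y, ∀ t, 0 ≤ t → t ≤ dist p q →
  ∃ r, dist p r = t ∧ dist r q = dist p q - t ∧ ∃ a ∈ Y, dist r a ≤ 5

theorem proj_lemma (h4 : P4 X) {Y : Set X} (hY : QC5 Y) {x q p : X}
    (hq : IsProjection 1 Y x q) (hp : p ∈ Y) : dist x q + dist p q - 32 ≤ dist x p := by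
  set t := (dist x q + dist p q - dist x p) / 2 with ht
  by_cases h0 : t < 0
  · linarith
  have i1 := dist_triangle x p q
  have i2 := dist_triangle q x p
  have i3 := dist_triangle x q p
  rw [dist_comm q x] at i2
  rw [dist_comm q p] at i2 i3
  obtain ⟨r, hr1, hr2, a, ha, hra⟩ := hY q hq.1 p hp t (by linarith)
    (by rw [dist_comm q p]; linarith)
  have h := h4 x r q p
  have j := hq.2 a ha
  have j1 := dist_triangle x r a
  rw [dist_comm r q, hr1, hr2, dist_comm q p] at h
  have : max (dist x q + (dist p q - t)) (dist x p + t) = dist x q + (dist p q - t) := by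
    rw [max_eq_left]; linarith
  rw [this] at h
  linarith

theorem two_proj (h4 : P4 X) {Y : Set X} (hY : QC5 Y) {x q x' q' : X}
    (hq : IsProjection 1 Y x q) (hq' : IsProjection 1 Y x' q') :
    dist x q + dist x' q' + dist q q' - 74 ≤ dist x x' ∨ dist q q' ≤ 37 := by
  have h1 := proj_lemma h4 hY hq hq'.1
  have h2 := proj_lemma h4 hY hq' hq.1
  have h := h4 x q' x' q
  rw [dist_comm q' q] at h h1
  rw [dist_comm q' x'] at h
  rcases max_choice (dist x x' + dist q q') (dist x q + dist x' q') with e | e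
  · left
    rw [e] at h
    linarith
  · right
    rw [e] at h
    linarith

theorem ov_min (h4 : P4 X) {Y : Set X} (hY : QC5 Y) {x1 q1 x2 q2 x3 q3 : X}
    (h1 : IsProjection 1 Y x1 q1) (h2 : IsProjection 1 Y x2 q2) (h3 : IsProjection 1 Y x3 q3)
    (h12 : 74 < dist x1 q1 + dist x2 q2 - dist x1 x2)
    (h23 : 74 < dist x2 q2 + dist x3 q3 - dist x2 x3) :
    min (dist x1 q1 + dist x2 q2 - dist x1 x2) (dist x2 q2 + dist x3 q3 - dist x2 x3) - 47
      ≤ dist x1 q1 + dist x3 q3 - dist x1 x3 := by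
  have d12 : dist q1 q2 ≤ 37 := by
    rcases two_proj h4 hY h1 h2 with e | e
    · linarith [dist_nonneg (x := q1) (y := q2)]
    · exact e
  have d23 : dist q2 q3 ≤ 37 := by
    rcases two_proj h4 hY h2 h3 with e | e
    · linarith [dist_nonneg (x := q2) (y := q3)]
    · exact e
  have h := h4 x1 x3 x2 q2
  have i1 := dist_triangle x1 q1 q2
  have i2 := dist_triangle x3 q3 q2
  rw [dist_comm q3 q2] at i2
  rw [dist_comm x3 x2] at h
  have m1 := min_le_left (dist x1 q1 + dist x2 q2 - dist x1 x2)
    (dist x2 q2 + dist x3 q3 - dist x2 x3)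
  have m2 := min_le_right (dist x1 q1 + dist x2 q2 - dist x1 x2)
    (dist x2 q2 + dist x3 q3 - dist x2 x3)
  rcases max_choice (dist x1 x2 + dist x3 q2) (dist x1 q2 + dist x2 x3) with e | e
  · rw [e] at h; linarith
  · rw [e] at h; linarith

theorem bridge_far (h4 : P4 X) {Y A B : Set X} (hY : QC5 Y) (hA : QC5 A) (hB : QC5 B)
    {x y x' y' : X} (hx : x ∈ A) (hy : y ∈ Y) (hx' : x' ∈ B) (hy' : y' ∈ Y)
    (br : ∀ w ∈ A, ∀ p ∈ Y, dist x y ≤ dist w p + 1)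
    (br' : ∀ w ∈ B, ∀ p ∈ Y, dist x' y' ≤ dist w p + 1)
    {C : ℝ} (hC : 74 ≤ C) (hov : dist x y + dist x' y' - dist x x' ≤ C)
    (hD : C + 100 < dist x y) (hD' : C + 100 < dist x' y')
    {w w' : X} (hw : w ∈ A) (hw' : w' ∈ B) :
    dist x y + dist x' y' - (C + 94) ≤ dist w w' := by
  have p1 : IsProjection 1 Y x y := ⟨hy, fun a ha => br x hx a ha⟩
  have p2 : IsProjection 1 Y x' y' := ⟨hy', fun a ha => br' x' hx' a ha⟩
  have p3 : IsProjection 1 A y x := ⟨hx, fun a ha => by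
    rw [dist_comm y x, dist_comm y a]; exact br a ha y hy⟩
  have p4 : IsProjection 1 B y' x' := ⟨hx', fun a ha => by
    rw [dist_comm y' x', dist_comm y' a]; exact br' a ha y' hy'⟩
  have e1 := proj_lemma h4 hA p3 hw
  have e2 := proj_lemma h4 hB p4 hw'
  rw [dist_comm y x, dist_comm y w] at e1
  rw [dist_comm y' x', dist_comm y' w'] at e2
  have t1 := dist_triangle x' y' y
  have t2 := dist_triangle x y y'
  rw [dist_comm y' y] at t1
  have e34 : dist x y + dist x' y - (C + 37) ≤ dist x x' ∧
      dist x' y' + dist x y' - (C + 37) ≤ dist x x' := by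
    rcases two_proj h4 hY p1 p2 with e | e
    · constructor <;> linarith
    · constructor <;> linarith
  obtain ⟨e3, e4⟩ := e34
  have e5 : dist w x + dist x x' - 42 ≤ dist w x' := by
    have h := h4 w y x' x
    rw [dist_comm x' x, dist_comm y x, dist_comm y x'] at h
    rcases max_choice (dist w x' + dist x y) (dist w x + dist x' y) with e | e
    · rw [e] at h; linarith
    · rw [e] at h; linarith
  have e6 : dist w' x' + dist x x' - 42 ≤ dist w' x := by
    have h := h4 w' y' x x'
    rw [dist_comm y' x, dist_comm y' x'] at h
    rcases max_choice (dist w' x + dist x' y') (dist w' x' + dist x y') with e | e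
    · rw [e] at h; linarith
    · rw [e] at h; linarith
  have h := h4 w x' w' x
  have n1 := dist_nonneg (x := w) (y := x)
  have n2 := dist_nonneg (x := w') (y := x')
  rw [dist_comm x' x, dist_comm x' w'] at h
  rcases max_choice (dist w w' + dist x x') (dist w x + dist w' x') with e | e
  · rw [e] at h; linarith
  · rw [e] at h; linarith

theorem comb {A G : Type*} [Group G] (V : Subgroup G) (ov : A → A → G → ℝ) (K k : ℝ) (hk : 0 ≤ k)
    (symm : ∀ a b, ∀ v ∈ V, ov a b v = ov b a v⁻¹)
    (tri : ∀ a b c, ∀ v ∈ V, ∀ w ∈ V, K < ov a b v → K < ov b c w →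
      min (ov a b v) (ov b c w) - k ≤ ov a c (v * w))
    (diag : ∀ a, ∀ v ∈ V, v ≠ 1 → ov a a v ≤ K) (S : Finset A) :
    ∃ t : A → G, (∀ a, t a ∈ V) ∧ ∀ a ∈ S, ∀ b ∈ S, ∀ v ∈ V, v ≠ 1 →
      ov a b ((t a)⁻¹ * v * t b) ≤ K + k * S.card := by
  classical
  induction S using Finset.induction_on with
  | empty => exact ⟨fun _ => 1, fun _ => V.one_mem, by simp⟩
  | insert b S hb ih =>
    obtain ⟨t, htV, ht⟩ := ih
    rw [Finset.card_insert_of_notMem hb]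
    push_cast
    have hc : 0 ≤ k * (S.card : ℝ) := by positivity
    have key : ∃ τ ∈ V, ∀ c ∈ S, ∀ w ∈ V, w ≠ 1 →
        ov c b ((t c)⁻¹ * w * τ) ≤ K + k * (S.card + 1) := by
      by_cases hex : ∃ a ∈ S, ∃ v ∈ V, K + k * (S.card + 1) < ov a b v
      · obtain ⟨a, ha, v, hv, hav⟩ := hex
        refine ⟨t a * v, V.mul_mem (htV a) hv, fun c hcS w hw hw1 => ?_⟩
        by_contra hcon
        push Not at hcon
        have hm : (t c)⁻¹ * w * (t a * v) ∈ V :=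
          V.mul_mem (V.mul_mem (V.inv_mem (htV c)) hw) (V.mul_mem (htV a) hv)
        rw [symm a b v hv] at hav
        have h := tri c b a _ hm _ (V.inv_mem hv) (by linarith) (by linarith)
        have e : (t c)⁻¹ * w * (t a * v) * v⁻¹ = (t c)⁻¹ * w * t a := by group
        rw [e] at h
        have h2 := ht c hcS a ha w hw hw1
        have h3 := lt_min hcon hav
        linarith
      · push Not at hex
        exact ⟨1, V.one_mem, fun c hcS w hw hw1 => hex c hcS _
          (V.mul_mem (V.mul_mem (V.inv_mem (htV c)) hw) V.one_mem)⟩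
    obtain ⟨τ, hτ, key⟩ := key
    refine ⟨Function.update t b τ, fun a => ?_, ?_⟩
    · by_cases h : a = b
      · subst h; simpa using hτ
      · rw [Function.update_of_ne h]; exact htV a
    · intro a ha c hcS v hv hv1
      by_cases hab : a = b
      · subst hab
        by_cases hca : c = a
        · subst hca
          rw [Function.update_self]
          have := diag c (τ⁻¹ * v * τ) (V.mul_mem (V.mul_mem (V.inv_mem hτ) hv) hτ) (by
            intro h
            apply hv1
            have : v = τ * (τ⁻¹ * v * τ) * τ⁻¹ := by group
            rw [this, h]; group)
          linarith
        · have hcS' := (Finset.mem_insert.mp hcS).resolve_left hca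
          rw [Function.update_self, Function.update_of_ne hca,
            symm _ _ _ (V.mul_mem (V.mul_mem (V.inv_mem hτ) hv) (htV c))]
          have e : (τ⁻¹ * v * t c)⁻¹ = (t c)⁻¹ * v⁻¹ * τ := by group
          rw [e]
          exact key c hcS' _ (V.inv_mem hv) (by simpa using hv1)
      · have ha' := (Finset.mem_insert.mp ha).resolve_left hab
        rw [Function.update_of_ne hab]
        by_cases hcb : c = b
        · subst hcb
          rw [Function.update_self]
          exact key a ha' v hv hv1
        · have hcS' := (Finset.mem_insert.mp hcS).resolve_left hcb
          rw [Function.update_of_ne hcb]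
          have := ht a ha' c hcS' v hv hv1
          linarith

theorem seg_trivial (x : X) : IsGeodesicSegment {x} x x :=
  ⟨0, fun _ => x, le_refl _, rfl, rfl, fun u hu v hv => by
    have h1 : u = 0 := le_antisymm hu.2 hu.1
    have h2 : v = 0 := le_antisymm hv.2 hv.1
    simp [h1, h2], by simp⟩

theorem seg_eq_of_same {s : Set X} {x : X} (h : IsGeodesicSegment s x x) : ∀ z ∈ s, z = x := by
  intro z hz
  have := seg_dist h hz
  rw [dist_self, dist_comm z x] at this
  have h2 := dist_nonneg (x := x) (y := z)
  exact (dist_le_zero.mp (by linarith : dist x z ≤ 0)).symm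

theorem quad (hyp : DeltaHyperbolic 1 X) {s s1 s2 s3 : Set X} {p q a b r : X}
    (h : IsGeodesicSegment s p q) (h1 : IsGeodesicSegment s1 p a)
    (h2 : IsGeodesicSegment s2 a b) (h3 : IsGeodesicSegment s3 b q) (hr : r ∈ s) :
    ∃ r' ∈ s1 ∪ s2 ∪ s3, dist r r' ≤ 2 := by
  obtain ⟨t, ht⟩ := hyp.1 p b
  obtain ⟨u, hu, hd⟩ := hyp.2 p q b s s3 t h (seg_symm h3) ht r hr
  rcases hu with hu | hu
  · exact ⟨u, Or.inr hu, by linarith⟩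
  · obtain ⟨w, hw, hd'⟩ := hyp.2 p b a t s2 s1 ht (seg_symm h2) h1 u hu
    refine ⟨w, Or.inl hw.symm, ?_⟩
    linarith [dist_triangle r u w]

theorem subset_conv (hg : GeodesicSpace X) (Z : Set X) {a : X} (ha : a ∈ Z) :
    a ∈ geoConv (Sum.inl '' Z : Set (X ⊕ Boundary X)) := by
  by_cases h : ∃ b ∈ Z, a ≠ b
  · obtain ⟨b, hb, hab⟩ := h
    obtain ⟨s, hs⟩ := hg a b
    refine Or.inr ⟨Sum.inl a, ⟨a, ha, rfl⟩, Sum.inl b, ⟨b, hb, rfl⟩, fun h => hab (Sum.inl.inj h),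
      s, hs, seg_left_mem hs⟩
  · push Not at h
    refine Or.inl ⟨a, ?_, rfl⟩
    have : Z = {a} := by
      ext z
      constructor
      · intro hz; exact (h z hz).symm
      · rintro rfl; exact ha
    rw [this, Set.image_singleton]

theorem seg_subset_conv (hg : GeodesicSpace X) (Z : Set X) {a c : X} (ha : a ∈ Z) (hc : c ∈ Z)
    {s : Set X} (hs : IsGeodesicSegment s a c) :
    s ⊆ geoConv (Sum.inl '' Z : Set (X ⊕ Boundary X)) := by
  intro z hz
  by_cases h : a = c
  · subst h
    rw [seg_eq_of_same hs z hz]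
    exact subset_conv hg Z ha
  · exact Or.inr ⟨Sum.inl a, ⟨a, ha, rfl⟩, Sum.inl c, ⟨c, hc, rfl⟩, fun h' => h (Sum.inl.inj h'),
      s, hs, hz⟩

theorem conv_seg (Z : Set X) {x : X}
    (hx : x ∈ geoConv (Sum.inl '' Z : Set (X ⊕ Boundary X))) :
    ∃ a ∈ Z, ∃ c ∈ Z, ∃ s, IsGeodesicSegment s a c ∧ x ∈ s := by
  rcases hx with ⟨a, hZ, rfl⟩ | ⟨p, ⟨a, ha, rfl⟩, q, ⟨c, hc, rfl⟩, _, s, hs, hxs⟩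
  · have : (Sum.inl x : X ⊕ Boundary X) ∈ (Sum.inl '' Z : Set (X ⊕ Boundary X)) := by
      rw [hZ]; rfl
    obtain ⟨z, hz, hzx⟩ := this
    have := Sum.inl.inj hzx
    subst this
    exact ⟨z, hz, z, hz, {z}, seg_trivial z, rfl⟩
  · exact ⟨a, ha, c, hc, s, hs, hxs⟩

theorem conv_qc (hyp : DeltaHyperbolic 1 X) (Z : Set X) :
    Quasiconvex 2 (geoConv (Sum.inl '' Z : Set (X ⊕ Boundary X))) := by
  intro x hx y hy s hs p hp
  obtain ⟨a, ha, b, hb, s1, hs1, hx1⟩ := conv_seg Z hx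
  obtain ⟨c, hc, d, hd, s2, hs2, hy2⟩ := conv_seg Z hy
  obtain ⟨u1, hu1, hsu1⟩ := seg_sub hs1 hx1
  obtain ⟨u2, hu2, hsu2⟩ := seg_sub hs2 hy2
  obtain ⟨t, ht⟩ := hyp.1 a c
  obtain ⟨r, hr, hdr⟩ := quad hyp hs (seg_symm hsu1) ht hsu2 hp
  refine ⟨r, ?_, hdr⟩
  rcases hr with (hr | hr) | hr
  · exact seg_subset_conv hyp.1 Z ha hb hs1 (hu1 hr)
  · exact seg_subset_conv hyp.1 Z ha hc ht hr
  · exact seg_subset_conv hyp.1 Z hc hd hs2 (hu2 hr)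

theorem closure_qc (hyp : DeltaHyperbolic 1 X) {Q : Set X} (hQ : Quasiconvex 2 Q) :
    QC5 (closure Q) := by
  intro p hp q hq t ht ht'
  obtain ⟨s, hs⟩ := hyp.1 p q
  obtain ⟨r, hr, hr1, hr2⟩ := seg_point hs ht ht'
  refine ⟨r, hr1, hr2, ?_⟩
  obtain ⟨p', hp', hpp⟩ := Metric.mem_closure_iff.mp hp 1 one_pos
  obtain ⟨q', hq', hqq⟩ := Metric.mem_closure_iff.mp hq 1 one_pos
  obtain ⟨s1, h1⟩ := hyp.1 p p'
  obtain ⟨s2, h2⟩ := hyp.1 p' q'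
  obtain ⟨s3, h3⟩ := hyp.1 q' q
  obtain ⟨u, hu, hd⟩ := quad hyp hs h1 h2 h3 hr
  rcases hu with (hu | hu) | hu
  · refine ⟨p', subset_closure hp', ?_⟩
    have := seg_dist h1 hu
    linarith [dist_triangle r u p', dist_nonneg (x := p) (y := u)]
  · obtain ⟨a, ha, hda⟩ := hQ p' hp' q' hq' s2 h2 u hu
    exact ⟨a, subset_closure ha, by linarith [dist_triangle r u a]⟩
  · refine ⟨q', subset_closure hq', ?_⟩
    have := seg_dist h3 hu
    rw [dist_comm q' q, dist_comm q' u] at this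
    linarith [dist_triangle r u q', dist_nonneg (x := u) (y := q)]

section Action

variable {G : Type*} [Group G] [MulAction G X]

theorem cHull_qc (hyp : DeltaHyperbolic 1 X) (V : Subgroup G) : QC5 (cHull X 1 V) :=
  closure_qc hyp (conv_qc hyp _)

theorem iso_dist (iso : IsometricAction G X) (g : G) (x y : X) :
    dist (g • x) (g • y) = dist x y := iso g x y

theorem ray_smul (iso : IsometricAction G X) (g : G) {γ : ℝ → X} (h : IsGeodesicRay γ) :
    IsGeodesicRay (fun t => g • γ t) := fun s t hs ht => by
  rw [iso]; exact h s t hs ht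

theorem asym_smul (iso : IsometricAction G X) (g : G) {γ γ' : ℝ → X} (h : Asymptotic γ γ') :
    Asymptotic (fun t => g • γ t) (fun t => g • γ' t) := by
  obtain ⟨K, h1, h2⟩ := h
  refine ⟨K, ?_, ?_⟩
  · rintro _ ⟨t, ht, rfl⟩
    obtain ⟨_, ⟨t', ht', rfl⟩, hd⟩ := h1 _ ⟨t, ht, rfl⟩
    exact ⟨_, ⟨t', ht', rfl⟩, by simpa only [iso_dist iso] using hd⟩
  · rintro _ ⟨t, ht, rfl⟩
    obtain ⟨_, ⟨t', ht', rfl⟩, hd⟩ := h2 _ ⟨t, ht, rfl⟩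
    exact ⟨_, ⟨t', ht', rfl⟩, by simpa only [iso_dist iso] using hd⟩

/-- The action on the boundary. -/
def bdMap (iso : IsometricAction G X) (g : G) : Boundary X → Boundary X :=
  Quotient.map' (s₁ := raySetoid X) (s₂ := raySetoid X)
    (fun γ => ⟨fun t => g • γ.1 t, ray_smul iso g γ.2⟩)
    (fun _ _ h => asym_smul iso g h)

theorem bdMap_mk (iso : IsometricAction G X) (g : G) (γ : GRay X) :
    bdMap iso g (Boundary.mk γ) = Boundary.mk ⟨fun t => g • γ.1 t, ray_smul iso g γ.2⟩ := rfl

theorem bdMap_inv (iso : IsometricAction G X) (g : G) (p : Boundary X) :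
    bdMap iso g⁻¹ (bdMap iso g p) = p := by
  obtain ⟨γ, rfl⟩ : ∃ γ, Boundary.mk γ = p := Quotient.exists_rep p
  refine congrArg Boundary.mk (Subtype.ext ?_)
  funext t
  exact inv_smul_smul g _

theorem seqConv_smul (iso : IsometricAction G X) (g : G) {x : X} {u : ℕ → X} {p : Boundary X}
    (h : SeqConvTo x u p) : SeqConvTo (g • x) (fun n => g • u n) (bdMap iso g p) := by
  obtain ⟨γ, rfl, h⟩ := h
  refine ⟨_, (bdMap_mk iso g γ).symm, ?_⟩
  simpa only [gromov, iso_dist iso] using h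

/-- The action on `X ∪ ∂X`. -/
def sumMap (iso : IsometricAction G X) (g : G) : X ⊕ Boundary X → X ⊕ Boundary X :=
  Sum.map (fun x => g • x) (bdMap iso g)

theorem sumMap_inv (iso : IsometricAction G X) (g : G) (p : X ⊕ Boundary X) :
    sumMap iso g⁻¹ (sumMap iso g p) = p := by
  rcases p with x | p
  · simp [sumMap]
  · simp [sumMap, bdMap_inv]

theorem join_smul (iso : IsometricAction G X) (g : G) {p q : X ⊕ Boundary X} {s : Set X}
    (h : JoinSet p q s) :
    JoinSet (sumMap iso g p) (sumMap iso g q) ((fun x => g • x) '' s) := by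
  have ray : ∀ (x : X) (p : Boundary X),
      (∃ γ : ℝ → X, γ 0 = x ∧ RayTo γ p ∧ s = γ '' Set.Ici 0) →
      ∃ γ : ℝ → X, γ 0 = g • x ∧ RayTo γ (bdMap iso g p) ∧
        (fun x => g • x) '' s = γ '' Set.Ici 0 := by
    rintro x p ⟨γ, h0, ⟨hr, hm⟩, rfl⟩
    refine ⟨fun t => g • γ t, by simp [h0], ⟨ray_smul iso g hr, ?_⟩, ?_⟩
    · rw [← hm]; rfl
    · rw [Set.image_image]
  rcases p with x | p <;> rcases q with y | q
  · obtain ⟨b, f, hb, h0, h1, hf, rfl⟩ := h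
    refine ⟨b, fun t => g • f t, hb, by simp [h0], by simp [h1], ?_, ?_⟩
    · intro u hu v hv
      rw [iso]; exact hf u hu v hv
    · rw [Set.image_image]
  · exact ray x q h
  · exact ray y p h
  · obtain ⟨γ, ⟨hb, h1, h2⟩, rfl⟩ := h
    refine ⟨fun t => g • γ t, ⟨fun s t => by rw [iso]; exact hb s t, seqConv_smul iso g h1,
      seqConv_smul iso g h2⟩, ?_⟩
    rw [← Set.range_comp]; rfl

theorem conv_smul (iso : IsometricAction G X) (g : G) {A : Set (X ⊕ Boundary X)}
    (hA : ∀ p ∈ A, sumMap iso g p ∈ A) {x : X} (hx : x ∈ geoConv A) : g • x ∈ geoConv A := by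
  rcases hx with ⟨a, hZ, rfl⟩ | ⟨p, hp, q, hq, hne, s, hs, hxs⟩
  · left
    have := hA (Sum.inl x) (by rw [hZ]; rfl)
    rw [hZ] at this
    exact ⟨x, hZ, Sum.inl.inj this⟩
  · right
    refine ⟨_, hA p hp, _, hA q hq, ?_, _, join_smul iso g hs, ⟨x, hxs, rfl⟩⟩
    intro h
    apply hne
    rw [← sumMap_inv iso g p, h, sumMap_inv]

theorem limitSet_smul (iso : IsometricAction G X) (V : Subgroup G) {g : G} (hg : g ∈ V)
    {p : Boundary X} (hp : p ∈ limitSet X V) : bdMap iso g p ∈ limitSet X V := by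
  obtain ⟨x, u, h⟩ := hp
  refine ⟨g • x, fun n => ⟨g, hg⟩ * u n * ⟨g, hg⟩⁻¹, ?_⟩
  have := seqConv_smul iso g h
  convert this using 2 with n
  simp [mul_smul]

theorem smallDisp_smul (iso : IsometricAction G X) (V : Subgroup G) {g : G} (hg : g ∈ V)
    {x : X} (hx : x ∈ smallDispSet X 1 V) : g • x ∈ smallDispSet X 1 V := by
  obtain ⟨u, hu, hu1, hd⟩ := hx
  refine ⟨g * u * g⁻¹, V.mul_mem (V.mul_mem hg hu) (V.inv_mem hg), ?_, ?_⟩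
  · intro h
    apply hu1
    have : u = g⁻¹ * (g * u * g⁻¹) * g := by group
    rw [this, h]; group
  · simpa [mul_smul, iso g] using hd

theorem ZSet_smul (iso : IsometricAction G X) (V : Subgroup G) {g : G} (hg : g ∈ V)
    {x : X} (hx : x ∈ ZSet X 1 V) : g • x ∈ ZSet X 1 V := by
  refine conv_smul iso g ?_ hx
  rintro _ (⟨p, hp, rfl⟩ | ⟨y, hy, rfl⟩)
  · exact Or.inl ⟨_, limitSet_smul iso V hg hp, rfl⟩
  · exact Or.inr ⟨_, smallDisp_smul iso V hg hy, rfl⟩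

theorem cHull_smul_mem (iso : IsometricAction G X) (V : Subgroup G) {g : G} (hg : g ∈ V)
    {x : X} (hx : x ∈ cHull X 1 V) : g • x ∈ cHull X 1 V := by
  have hmaps : Set.MapsTo (fun y : X => g • y) (geoConv (Sum.inl '' ZSet X 1 V))
      (geoConv (Sum.inl '' ZSet X 1 V)) := by
    intro y hy
    refine conv_smul iso g ?_ hy
    rintro _ ⟨z, hz, rfl⟩
    exact ⟨_, ZSet_smul iso V hg hz, rfl⟩
  have hc : Continuous (fun y : X => g • y) :=
    (Isometry.of_dist_eq fun a b => iso g a b).continuous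
  exact hmaps.closure hc hx

theorem cHull_smul (iso : IsometricAction G X) (V : Subgroup G) {g : G} (hg : g ∈ V) :
    g • cHull X 1 V = cHull X 1 V := by
  ext x
  rw [Set.mem_smul_set_iff_inv_smul_mem]
  constructor
  · intro h
    have := cHull_smul_mem iso V hg h
    simpa using this
  · exact cHull_smul_mem iso V (V.inv_mem hg)

theorem smallDisp_mem (sg : StronglyGeodesic X) (V : Subgroup G) {v : G} (hv : v ∈ V)
    (hv1 : v ≠ 1) {x : X} (hx : dist x (v • x) ≤ 100) : x ∈ cHull X 1 V := by
  apply subset_closure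
  apply subset_conv sg.1
  have hE : x ∈ smallDispSet X 1 V := ⟨v, hv, hv1, by linarith⟩
  set A : Set (X ⊕ Boundary X) := Sum.inr '' limitSet X V ∪ Sum.inl '' smallDispSet X 1 V with hA
  have hxA : Sum.inl x ∈ A := Or.inr ⟨x, hE, rfl⟩
  change x ∈ geoConv A
  by_cases h : ∃ q ∈ A, Sum.inl x ≠ q
  · right
    obtain ⟨q, hq, hne⟩ := h
    rcases q with y | p
    · obtain ⟨s, hs⟩ := sg.1 x y
      exact ⟨_, hxA, _, hq, hne, s, hs, seg_left_mem hs⟩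
    · obtain ⟨γ, rfl⟩ : ∃ γ, Boundary.mk γ = p := Quotient.exists_rep p
      obtain ⟨γ', hr, h0, has⟩ := sg.2.1 γ.1 γ.2 x
      refine ⟨_, hxA, _, hq, hne, γ' '' Set.Ici 0, ⟨γ', h0, ⟨hr, ?_⟩, rfl⟩, ⟨0, by simp, h0⟩⟩
      exact Quotient.sound (s := raySetoid X) (asymptotic_symm has)
  · push Not at h
    left
    refine ⟨x, ?_, rfl⟩
    ext q
    constructor
    · intro hq; exact (h q hq).symm
    · rintro rfl; exact hxA

theorem setDist_nonneg (A B : Set X) : 0 ≤ setDist A B := by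
  apply Real.sInf_nonneg
  rintro _ ⟨a, _, b, _, rfl⟩
  exact dist_nonneg

theorem setDist_le {A B : Set X} {a b : X} (ha : a ∈ A) (hb : b ∈ B) :
    setDist A B ≤ dist a b :=
  csInf_le ⟨0, by rintro _ ⟨a, _, b, _, rfl⟩; exact dist_nonneg⟩ ⟨a, ha, b, hb, rfl⟩

theorem setDist_comm (A B : Set X) : setDist A B = setDist B A := by
  unfold setDist
  congr 1
  rw [Set.image2_swap]
  simp only [dist_comm]

theorem setDist_smul (iso : IsometricAction G X) (g : G) (A B : Set X) :
    setDist (g • A) (g • B) = setDist A B := by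
  unfold setDist
  congr 1
  ext r
  constructor
  · rintro ⟨_, ⟨a, ha, rfl⟩, _, ⟨b, hb, rfl⟩, rfl⟩
    exact ⟨a, ha, b, hb, (iso g a b).symm⟩
  · rintro ⟨a, ha, b, hb, rfl⟩
    exact ⟨g • a, ⟨a, ha, rfl⟩, g • b, ⟨b, hb, rfl⟩, iso g a b⟩

theorem lV_nonneg (V : Subgroup G) (g : G) : 0 ≤ lV X 1 V g := setDist_nonneg _ _

theorem lV_eq (iso : IsometricAction G X) (V : Subgroup G) (g h : G) :
    lV X 1 V (g⁻¹ * h) = setDist (g • cHull X 1 V) (h • cHull X 1 V) := by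
  unfold lV
  rw [← setDist_smul iso g, smul_smul]
  simp

theorem lV_inv (iso : IsometricAction G X) (V : Subgroup G) (g : G) :
    lV X 1 V g⁻¹ = lV X 1 V g := by
  have h := lV_eq iso V g 1
  rw [mul_one, one_smul, setDist_comm] at h
  exact h

theorem lV_mul (iso : IsometricAction G X) (V : Subgroup G) (g : G) {v w : G} (hv : v ∈ V)
    (hw : w ∈ V) : lV X 1 V (v * g * w) = lV X 1 V g := by
  have h := lV_eq iso V v⁻¹ (g * w)
  rw [inv_inv, ← mul_assoc, cHull_smul iso V (V.inv_mem hv), mul_smul, cHull_smul iso V hw] at h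
  exact h

theorem qc5_smul (iso : IsometricAction G X) (g : G) {Y : Set X} (hY : QC5 Y) : QC5 (g • Y) := by
  rintro _ ⟨p, hp, rfl⟩ _ ⟨q, hq, rfl⟩ t ht ht'
  simp only [iso_dist iso] at ht' ⊢
  obtain ⟨r, h1, h2, a, ha, h3⟩ := hY p hp q hq t ht ht'
  refine ⟨g • r, ?_, ?_, g • a, ⟨a, ha, rfl⟩, ?_⟩ <;> rwa [iso]

theorem equiv_translate {m : ℕ} (V : Subgroup G) (H s r : Fin m → G) (hs : ∀ i, s i ∈ V)
    (hr : ∀ i, r i ∈ V) :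
    gEquiv ((fun _ : Fin 1 => V), H) ((fun _ : Fin 1 => V), fun i => s i * H i * r i) := by
  classical
  have key : ∀ S : Finset (Fin m), gEquiv ((fun _ : Fin 1 => V), H)
      ((fun _ : Fin 1 => V), fun i => if i ∈ S then s i * H i * r i else H i) := by
    intro S
    induction S using Finset.induction_on with
    | empty =>
      have e : (fun i => if i ∈ (∅ : Finset (Fin m)) then s i * H i * r i else H i) = H := by
        funext i; simp
      rw [e]
      exact Relation.ReflTransGen.refl
    | insert a S ha ih =>
      refine Relation.ReflTransGen.tail ih (Or.inr ⟨rfl, a, s a, r a, ?_, ?_, ?_, ?_⟩)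
      · exact Subgroup.subset_closure (Or.inr (Set.mem_iUnion.mpr ⟨0, hs a⟩))
      · exact Subgroup.subset_closure (Or.inr (Set.mem_iUnion.mpr ⟨0, hr a⟩))
      · intro j hj
        simp [Finset.mem_insert, hj]
      · simp [ha]
  simpa using key Finset.univ

theorem minimal_ineq (iso : IsometricAction G X) {m : ℕ} {V : Subgroup G} {H : Fin m → G}
    (hmin : PairMinimal X V H) {i j : Fin m} (hij : i ≠ j) {h hb v : G}
    (hh : h = H i ∨ h = (H i)⁻¹) (hhb : hb = H j ∨ hb = (H j)⁻¹) (hv : v ∈ V) :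
    lV X 1 V hb ≤ lV X 1 V (h * v * hb) + 1 := by
  classical
  set S : Subgroup G := Subgroup.closure (H '' {k : Fin m | k ≠ j} ∪ ⋃ _ : Fin 1, (V : Set G))
    with hS
  have hvS : v ∈ S := Subgroup.subset_closure (Or.inr (Set.mem_iUnion.mpr ⟨0, hv⟩))
  have hiS : H i ∈ S := Subgroup.subset_closure (Or.inl ⟨i, hij, rfl⟩)
  have hhS : h ∈ S := by
    rcases hh with rfl | rfl
    · exact hiS
    · exact S.inv_mem hiS
  have main : ∀ g₁ ∈ S, ∀ g₂ ∈ S, lV X 1 V (H j) ≤ lV X 1 V (g₁ * H j * g₂) + 1 := by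
    intro g₁ h₁ g₂ h₂
    have hmove : gEquiv ((fun _ : Fin 1 => V), H)
        ((fun _ : Fin 1 => V), Function.update H j (g₁ * H j * g₂)) := by
      refine Relation.ReflTransGen.single (Or.inr ⟨rfl, j, g₁, g₂, h₁, h₂, ?_, ?_⟩)
      · intro k hk
        simp [hk]
      · simp
    have h := hmin _ _ hmove
    rw [← Finset.add_sum_erase _ _ (Finset.mem_univ j),
      ← Finset.add_sum_erase _ (fun k => lV X 1 V (Function.update H j (g₁ * H j * g₂) k))
        (Finset.mem_univ j)] at h
    have e : ∑ k ∈ Finset.univ.erase j, lV X 1 V (Function.update H j (g₁ * H j * g₂) k)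
        = ∑ k ∈ Finset.univ.erase j, lV X 1 V (H k) := by
      refine Finset.sum_congr rfl fun k hk => ?_
      rw [Function.update_of_ne (Finset.ne_of_mem_erase hk)]
    rw [e] at h
    simp only [Function.update_self] at h
    linarith
  rcases hhb with rfl | rfl
  · have := main (h * v) (S.mul_mem hhS hvS) 1 S.one_mem
    rwa [mul_one] at this
  · have := main 1 S.one_mem (v⁻¹ * h⁻¹) (S.mul_mem (S.inv_mem hvS) (S.inv_mem hhS))
    rw [lV_inv iso, ← lV_inv iso V (h * v * (H j)⁻¹)]
    convert this using 3
    group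

theorem exists_minimal {m : ℕ} (V' : Subgroup G) (H' : Fin m → G) :
    ∃ (V : Subgroup G) (H : Fin m → G),
      gEquiv ((fun _ : Fin 1 => V'), H') ((fun _ : Fin 1 => V), H) ∧ PairMinimal X V H := by
  set T : Set ℝ := {r | ∃ (V : Subgroup G) (H : Fin m → G),
      gEquiv ((fun _ : Fin 1 => V'), H') ((fun _ : Fin 1 => V), H) ∧
      r = ∑ i, lV X 1 V (H i)} with hT
  have hne : T.Nonempty := ⟨_, V', H', Relation.ReflTransGen.refl, rfl⟩
  have hbd : BddBelow T := by
    refine ⟨0, ?_⟩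
    rintro _ ⟨V, H, _, rfl⟩
    exact Finset.sum_nonneg fun i _ => lV_nonneg V (H i)
  obtain ⟨_, ⟨V, H, hE, rfl⟩, hlt⟩ := exists_lt_of_csInf_lt hne
    (show sInf T < sInf T + 1 by linarith)
  refine ⟨V, H, hE, fun V2 H2 h2 => ?_⟩
  have := csInf_le hbd ⟨V2, H2, Relation.ReflTransGen.trans hE h2, rfl⟩
  linarith

theorem diag_bound (iso : IsometricAction G X) (sg : StronglyGeodesic X) (h4 : P4 X)
    {V : Subgroup G} (hY : QC5 (cHull X 1 V)) {x y : X} (hxy : IsProjection 1 (cHull X 1 V) x y)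
    {v : G} (hv : v ∈ V) (hv1 : v ≠ 1) :
    dist x y + dist x y - dist x (v • x) ≤ 74 := by
  by_contra hcon
  push Not at hcon
  have hxy' : IsProjection 1 (cHull X 1 V) (v • x) (v • y) := by
    refine ⟨cHull_smul_mem iso V hv hxy.1, fun a ha => ?_⟩
    have h := hxy.2 (v⁻¹ • a) (cHull_smul_mem iso V (V.inv_mem hv) ha)
    rw [iso]
    have e := iso v x (v⁻¹ • a)
    rw [smul_inv_smul] at e
    rwa [e]
  have hd : dist y (v • y) ≤ 37 := by
    rcases two_proj h4 hY hxy hxy' with e | e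
    · rw [iso_dist iso] at e
      linarith [dist_nonneg (x := y) (y := v • y)]
    · exact e
  have hn := dist_nonneg (x := x) (y := v • x)
  obtain ⟨s, hs⟩ := sg.1 y x
  obtain ⟨p, _, hp1, hp2⟩ := seg_point hs (t := 2) (by norm_num) (by rw [dist_comm y x]; linarith)
  have hp : p ∈ cHull X 1 V := by
    apply smallDisp_mem sg V hv hv1
    have i1 := dist_triangle4 p y (v • y) (v • p)
    rw [iso_dist iso, dist_comm p y] at i1
    linarith
  have := hxy.2 p hp
  rw [dist_comm x p, dist_comm x y] at this
  linarith

theorem main_aux {m : ℕ} (iso : IsometricAction G X) (sg : StronglyGeodesic X)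
    (hyp : DeltaHyperbolic 1 X) (V : Subgroup G) (H₀ : Fin m → G) (hmin₀ : PairMinimal X V H₀) :
    ∃ H : Fin m → G, gEquiv ((fun _ : Fin 1 => V), H₀) ((fun _ : Fin 1 => V), H) ∧
      PairMinimal X V H ∧
      ∀ h hbar : G, h ∈ Set.range H ∪ (Set.range H)⁻¹ →
        hbar ∈ Set.range H ∪ (Set.range H)⁻¹ →
        ∀ v : G, v ∈ V → v ≠ 1 →
          lV X 1 V h + lV X 1 V hbar - (2 * (74 + 47 * (2 * m : ℝ)) + 300)
            ≤ lV X 1 V (h * v * hbar) := by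
  classical
  set Y := cHull X 1 V with hYdef
  have hm0 : (0 : ℝ) ≤ m := Nat.cast_nonneg m
  rcases Y.eq_empty_or_nonempty with hemp | hne
  · refine ⟨H₀, Relation.ReflTransGen.refl, hmin₀, ?_⟩
    have hz : ∀ g : G, lV X 1 V g = 0 := by
      intro g
      unfold lV setDist
      rw [← hYdef, hemp, Set.image2_empty_left, Real.sInf_empty]
    intro h hbar _ _ v _ _
    rw [hz, hz, hz]
    linarith
  have h4 := p4_of_hyp hyp
  have hY : QC5 Y := cHull_qc hyp V
  set g₀ : Fin m × Bool → G := fun a => if a.2 then H₀ a.1 else (H₀ a.1)⁻¹ with hg₀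
  have hbr : ∀ a, ∃ x y, x ∈ g₀ a • Y ∧ y ∈ Y ∧ dist x y ≤ lV X 1 V (g₀ a) + 1 := by
    intro a
    obtain ⟨y0, hy0⟩ := hne
    have hne2 : (Set.image2 dist Y (g₀ a • Y)).Nonempty :=
      ⟨_, y0, hy0, g₀ a • y0, ⟨y0, hy0, rfl⟩, rfl⟩
    obtain ⟨_, ⟨y, hy, x, hx, rfl⟩, hlt⟩ := exists_lt_of_csInf_lt hne2
      (show sInf (Set.image2 dist Y (g₀ a • Y)) < lV X 1 V (g₀ a) + 1 from lt_add_one _)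
    exact ⟨x, y, hx, hy, by rw [dist_comm]; exact hlt.le⟩
  choose x y hx hy hxy using hbr
  have hlow : ∀ a, ∀ w ∈ g₀ a • Y, ∀ p ∈ Y, lV X 1 V (g₀ a) ≤ dist w p := by
    intro a w hw p hp
    rw [dist_comm]
    exact setDist_le hp hw
  have hproj : ∀ a, ∀ v ∈ V, IsProjection 1 Y (v • x a) (v • y a) := by
    intro a v hv
    refine ⟨cHull_smul_mem iso V hv (hy a), fun p hp => ?_⟩
    have h := hlow a (x a) (hx a) (v⁻¹ • p) (cHull_smul_mem iso V (V.inv_mem hv) hp)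
    have e := iso v (x a) (v⁻¹ • p)
    rw [smul_inv_smul] at e
    rw [iso, e]
    linarith [hxy a]
  have hproj1 : ∀ a, IsProjection 1 Y (x a) (y a) := fun a => by
    simpa using hproj a 1 V.one_mem
  set ov : Fin m × Bool → Fin m × Bool → G → ℝ := fun a b v =>
    dist (x a) (y a) + dist (x b) (y b) - dist (x a) (v • x b) with hov
  obtain ⟨t, htV, ht⟩ := comb V ov 74 47 (by norm_num)
    (by
      intro a b v _
      have e := iso v⁻¹ (x a) (v • x b)
      rw [inv_smul_smul] at e
      simp only [hov]
      rw [← e, dist_comm (v⁻¹ • x a)]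
      ring)
    (by
      intro a b c v hv w hw h1 h2
      simp only [hov] at h1 h2 ⊢
      have e1 : dist (x b) (w • x c) = dist (v • x b) ((v * w) • x c) := by
        rw [mul_smul, iso]
      have f2 := iso v (x b) (y b)
      have f3 := iso (v * w) (x c) (y c)
      rw [e1, ← f2, ← f3] at h2
      rw [← f2] at h1
      have := ov_min h4 hY (hproj1 a) (hproj b v hv) (hproj c (v * w) (V.mul_mem hv hw)) h1 h2
      rw [← e1, f2, f3] at this
      exact this)
    (by
      intro a v hv hv1
      exact diag_bound iso sg h4 hY (hproj1 a) hv hv1)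
    Finset.univ
  have hcard : ((Finset.univ : Finset (Fin m × Bool)).card : ℝ) = 2 * m := by
    simp [mul_comm]
  rw [hcard] at ht
  set C : ℝ := 74 + 47 * (2 * m : ℝ) with hC
  have hC74 : 74 ≤ C := by linarith
  set H : Fin m → G := fun i => t (i, true) * H₀ i * (t (i, false))⁻¹ with hH
  have hE : gEquiv ((fun _ : Fin 1 => V), H₀) ((fun _ : Fin 1 => V), H) :=
    equiv_translate V H₀ (fun i => t (i, true)) (fun i => (t (i, false))⁻¹)
      (fun i => htV _) (fun i => V.inv_mem (htV _))
  have hmin : PairMinimal X V H := by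
    intro V2 H2 h2
    have h := hmin₀ V2 H2 (Relation.ReflTransGen.trans hE h2)
    have e : ∑ i, lV X 1 V (H i) = ∑ i, lV X 1 V (H₀ i) :=
      Finset.sum_congr rfl fun i _ => lV_mul iso V (H₀ i) (htV _) (V.inv_mem (htV _))
    rw [e]; exact h
  refine ⟨H, hE, hmin, ?_⟩
  -- every letter is a translate of some `g₀ a`
  have hrep : ∀ h ∈ Set.range H ∪ (Set.range H)⁻¹, ∃ a : Fin m × Bool,
      (h = H a.1 ∨ h = (H a.1)⁻¹) ∧ h = t a * g₀ a * (t (a.1, !a.2))⁻¹ := by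
    rintro h (⟨i, rfl⟩ | ⟨i, hi⟩)
    · exact ⟨(i, true), Or.inl rfl, by simp [hH, hg₀]⟩
    · have hi' : h = (H i)⁻¹ := by rw [hi, inv_inv]
      refine ⟨(i, false), Or.inr hi', ?_⟩
      rw [hi']
      simp [hH, hg₀, mul_assoc]
  intro h hbar hh hhbar v hv hv1
  have hhinv : h⁻¹ ∈ Set.range H ∪ (Set.range H)⁻¹ := by
    rcases hh with hh | hh
    · exact Or.inr (by simpa using hh)
    · exact Or.inl hh
  obtain ⟨a, ha1, ha2⟩ := hrep h⁻¹ hhinv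
  obtain ⟨b, hb1, hb2⟩ := hrep hbar hhbar
  have ha1' : h = H a.1 ∨ h = (H a.1)⁻¹ := by
    rcases ha1 with e | e
    · right; rw [← e, inv_inv]
    · left; exact inv_injective e
  have la : lV X 1 V h = lV X 1 V (g₀ a) := by
    rw [← lV_inv iso, ha2]
    exact lV_mul iso V _ (htV _) (V.inv_mem (htV _))
  have lb : lV X 1 V hbar = lV X 1 V (g₀ b) := by
    rw [hb2]
    exact lV_mul iso V _ (htV _) (V.inv_mem (htV _))
  have lnn := lV_nonneg (X := X) V (h * v * hbar)
  by_cases hbig : C + 100 < lV X 1 V h ∧ C + 100 < lV X 1 V hbar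
  · obtain ⟨hbh, hbhb⟩ := hbig
    have sa : h⁻¹ • Y = (t a * g₀ a) • Y := by
      rw [ha2, mul_smul, cHull_smul iso V (V.inv_mem (htV _))]
    have sb : (v * hbar) • Y = (v * t b * g₀ b) • Y := by
      rw [hb2, ← mul_assoc, mul_smul, cHull_smul iso V (V.inv_mem (htV _)), mul_assoc]
    have e0 : h * v * hbar = (h⁻¹)⁻¹ * (v * hbar) := by group
    rw [e0, lV_eq iso, ← hYdef, sa, sb]
    have bridge : ∀ c, ∀ u ∈ V, ∀ w ∈ (u * g₀ c) • Y, ∀ p ∈ Y,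
        dist (u • x c) (u • y c) ≤ dist w p + 1 := by
      intro c u hu w hw p hp
      rw [mul_smul] at hw
      obtain ⟨w0, hw0, rfl⟩ := hw
      have h := hlow c w0 hw0 (u⁻¹ • p) (cHull_smul_mem iso V (V.inv_mem hu) hp)
      have e := iso u w0 (u⁻¹ • p)
      rw [smul_inv_smul] at e
      simp only [iso_dist iso, e]
      linarith [hxy c]
    have hvt : v * t b ∈ V := V.mul_mem hv (htV b)
    have hmemx : ∀ c u, u • x c ∈ (u * g₀ c) • Y := fun c u => by
      rw [mul_smul]; exact ⟨x c, hx c, rfl⟩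
    have ga := hlow a (x a) (hx a) (y a) (hy a)
    have gb := hlow b (x b) (hx b) (y b) (hy b)
    have ov0 := ht a (Finset.mem_univ _) b (Finset.mem_univ _) v hv hv1
    simp only [hov] at ov0
    have e1 : dist (t a • x a) ((v * t b) • x b) = dist (x a) (((t a)⁻¹ * v * t b) • x b) := by
      rw [← iso (t a) (x a), smul_smul]
      congr 2
      group
    obtain ⟨y0, hy0⟩ := hne
    apply le_csInf
    · exact ⟨_, (t a * g₀ a) • y0, ⟨y0, hy0, rfl⟩, (v * t b * g₀ b) • y0, ⟨y0, hy0, rfl⟩, rfl⟩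
    · rintro _ ⟨w, hw, w', hw', rfl⟩
      have := bridge_far h4 hY (qc5_smul iso (t a * g₀ a) hY) (qc5_smul iso (v * t b * g₀ b) hY)
        (hmemx a (t a)) (cHull_smul_mem iso V (htV a) (hy a))
        (hmemx b (v * t b)) (cHull_smul_mem iso V hvt (hy b))
        (bridge a (t a) (htV a)) (bridge b (v * t b) hvt) hC74
        (by rw [e1, iso, iso]; exact ov0)
        (by rw [iso]; linarith) (by rw [iso]; linarith) hw hw'
      rw [iso_dist iso, iso_dist iso] at this
      linarith
  · by_cases hab : a.1 = b.1
    · have hHa : lV X 1 V h = lV X 1 V (H a.1) := by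
        rcases ha1' with e | e
        · rw [e]
        · rw [e, lV_inv iso]
      have hHb : lV X 1 V hbar = lV X 1 V (H a.1) := by
        rw [hab]
        rcases hb1 with e | e
        · rw [e]
        · rw [e, lV_inv iso]
      rw [hHa, hHb] at hbig ⊢
      simp only [and_self, not_lt] at hbig
      linarith
    · have i1 := minimal_ineq iso hmin hab ha1' hb1 hv
      have hb1' : hbar⁻¹ = H b.1 ∨ hbar⁻¹ = (H b.1)⁻¹ := by
        rcases hb1 with e | e
        · right; rw [e]
        · left; rw [e, inv_inv]
      have i2 := minimal_ineq iso hmin (Ne.symm hab) hb1' ha1 (V.inv_mem hv)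
      have e : hbar⁻¹ * v⁻¹ * h⁻¹ = (h * v * hbar)⁻¹ := by group
      rw [e, lV_inv iso, lV_inv iso] at i2
      rw [not_and_or, not_lt, not_lt] at hbig
      rcases hbig with hbig | hbig <;> linarith

end Action

end Helpers

theorem statement17 (m : ℕ) (hm : 1 ≤ m) :
    ∃ c : ℝ, 0 ≤ c ∧ ∀ (G : Type u) (X : Type v)
      [Group G] [MetricSpace X] [MulAction G X],
      IsometricAction G X → StronglyGeodesic X → DeltaHyperbolic 1 X →
      ∀ (V' : Subgroup G) (H' : Fin m → G), V' ≠ ⊥ →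
        ∃ (V : Subgroup G) (H : Fin m → G),
          gEquiv ((fun _ : Fin 1 => V'), H') ((fun _ : Fin 1 => V), H) ∧
          PairMinimal X V H ∧
          ∀ h hbar : G, h ∈ Set.range H ∪ (Set.range H)⁻¹ →
            hbar ∈ Set.range H ∪ (Set.range H)⁻¹ →
            ∀ v : G, v ∈ V → v ≠ 1 →
              lV X 1 V h + lV X 1 V hbar - c ≤ lV X 1 V (h * v * hbar) := by
  refine ⟨2 * (74 + 47 * (2 * m : ℝ)) + 300, by positivity, ?_⟩
  intro G X _ _ _ iso sg hyp V' H' _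
  obtain ⟨V, H₀, hE, hmin⟩ := exists_minimal (X := X) V' H'
  obtain ⟨H, hE2, hmin2, hmain⟩ := main_aux iso sg hyp V H₀ hmin
  exact ⟨V, H, Relation.ReflTransGen.trans hE hE2, hmin2, hmain⟩

end KW
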